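/- Suppose the linear inverse-problem setup and accuracy assumptions hold, and that x̂ ∈ X satisfies the basic source condition for some ŵ ∈ Y, i.e. Ax̂ = b̂ and 0 ∈ A*ŵ + ∂R(x̂). Then for every δ > 0 the Bregman divergence satisfies 0 ≤ B_R^{−A*ŵ}(x_δ, x̂) ≤ e_δ/α_δ + δ²/α_δ + α_δ‖ŵ‖_Y². -/

import Mathlib

open scoped RealInnerProductSpace
open Filter Topology Metric

/-- **Bregman-divergence estimate for Tikhonov-style regularisation of linear
inverse problems** (Theorem `thm:linear:bregman`).  `X` is a Banach space, `Y` a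
Hilbert space, `A : X → Y` bounded linear, `R` a convex, proper, lower
semicontinuous regulariser.  The corrupted data `b δ` satisfies `‖b δ - b̂‖ ≤ δ`,
and the approximate solutions `x δ` solve the regularised problem to accuracy
`e δ` relative to every `R`-minimising solution (characterised by the basic
source condition).  If `x̂` satisfies the basic source condition `A x̂ = b̂`,
`0 ∈ A*ŵ + ∂R(x̂)`, then the Bregman divergence
`B_R^{-A*ŵ}(x_δ, x̂) = ⟨-A*ŵ, x̂ - x_δ⟩ + R(x_δ) - R(x̂)` satisfies
`0 ≤ B ≤ e_δ/α_δ + δ²/α_δ + α_δ ‖ŵ‖²`. -/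
theorem bregman_divergence_estimate
    {X Y : Type*} [NormedAddCommGroup X] [NormedSpace ℝ X] [CompleteSpace X]
    [NormedAddCommGroup Y] [InnerProductSpace ℝ Y] [CompleteSpace Y]
    (A : X →L[ℝ] Y) (R : X → EReal)
    (hconv : ∀ p q : X, ∀ t : ℝ, 0 ≤ t → t ≤ 1 →
      R (t • p + (1 - t) • q) ≤ (t : EReal) * R p + ((1 - t : ℝ) : EReal) * R q)
    (hproper : ∃ p, R p ≠ ⊤) (hnebot : ∀ p, R p ≠ ⊥)
    (hlsc : LowerSemicontinuous R)
    (bhat : Y) (b : ℝ → Y) (hb : ∀ δ : ℝ, 0 < δ → ‖b δ - bhat‖ ≤ δ)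
    (α e : ℝ → ℝ) (hα : ∀ δ : ℝ, 0 < δ → 0 < α δ) (he : ∀ δ : ℝ, 0 < δ → 0 ≤ e δ)
    (x : ℝ → X) (xhat : X) (what : Y)
    (hsol : A xhat = bhat)
    (hsource : ∀ z : X, R xhat + ((-⟪what, A (z - xhat)⟫ : ℝ) : EReal) ≤ R z)
    (hacc : ∀ δ : ℝ, 0 < δ → ∀ xh : X, A xh = bhat →
      (∃ w : Y, ∀ z : X, R xh + ((-⟪w, A (z - xh)⟫ : ℝ) : EReal) ≤ R z) →
      ((2⁻¹ * ‖A (x δ) - b δ‖ ^ 2 : ℝ) : EReal) + (α δ : EReal) * R (x δ)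
        ≤ ((2⁻¹ * ‖A xh - b δ‖ ^ 2 : ℝ) : EReal) + (α δ : EReal) * R xh
          + (e δ : EReal)) :
    ∀ δ : ℝ, 0 < δ →
      (0 : EReal) ≤ ((-⟪what, A (xhat - x δ)⟫ : ℝ) : EReal) + R (x δ) - R xhat ∧
      ((-⟪what, A (xhat - x δ)⟫ : ℝ) : EReal) + R (x δ) - R xhat
        ≤ ((e δ / α δ + δ ^ 2 / α δ + α δ * ‖what‖ ^ 2 : ℝ) : EReal) := by
  intro δ hδ
  have hδα := hα δ hδ
  have hxhat : R xhat ≠ ⊤ := by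
    intro h
    obtain ⟨p, hp⟩ := hproper
    have := hsource p
    rw [h, EReal.top_add_coe] at this
    exact hp (top_le_iff.mp this)
  obtain ⟨rhat, hrhat⟩ : ∃ r : ℝ, R xhat = r :=
    ⟨_, (EReal.coe_toReal hxhat (hnebot xhat)).symm⟩
  have hopt := hacc δ hδ xhat hsol ⟨what, hsource⟩
  have hx : R (x δ) ≠ ⊤ := by
    intro h
    rw [h, hrhat, EReal.coe_mul_top_of_pos hδα, EReal.coe_add_top, top_le_iff] at hopt
    exact EReal.coe_ne_top _ (by exact_mod_cast hopt)
  obtain ⟨r, hr⟩ : ∃ r : ℝ, R (x δ) = r :=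
    ⟨_, (EReal.coe_toReal hx (hnebot (x δ))).symm⟩
  have hsub := hsource (x δ)
  rw [hr, hrhat] at hsub hopt
  rw [hr, hrhat]
  norm_cast at hsub hopt ⊢
  rw [map_sub, hsol] at hsub ⊢
  rw [hsol] at hopt
  have hflip : ⟪what, bhat - A (x δ)⟫ = -⟪what, A (x δ) - bhat⟫ := by
    rw [← inner_neg_right, neg_sub]
  refine ⟨by linarith, ?_⟩
  have hnoise : ‖bhat - b δ‖ ^ 2 ≤ δ ^ 2 := by
    rw [norm_sub_rev]
    exact pow_le_pow_left₀ (norm_nonneg _) (hb δ hδ) 2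
  have hsplit : ⟪what, A (x δ) - bhat⟫ =
      ⟪what, A (x δ) - b δ⟫ - ⟪what, bhat - b δ⟫ := by
    rw [← inner_sub_right, sub_sub_sub_cancel_right]
  have hres := norm_sub_sq_real (α δ • what) (A (x δ) - b δ)
  have hdata := norm_add_sq_real (α δ • what) (bhat - b δ)
  rw [real_inner_smul_left, norm_smul, mul_pow, Real.norm_eq_abs, sq_abs] at hres hdata
  have hres_nonneg := sq_nonneg ‖α δ • what - (A (x δ) - b δ)‖
  have hdata_nonneg := sq_nonneg ‖α δ • what + (bhat - b δ)‖
  have hrhs : e δ / α δ + δ ^ 2 / α δ + α δ * ‖what‖ ^ 2 =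
      (e δ + δ ^ 2 + α δ ^ 2 * ‖what‖ ^ 2) / α δ := by
    field_simp
  rw [hrhs, le_div_iff₀ hδα, hflip, hsplit]
  linarith
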